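/- There exists N₀ ∈ (1,2) such that for every real number N > N₀: the infimum α_N := inf_{a∈ℝ} α(a) satisfies α_N < 2N, and for every α₀ ∈ (α_N, 2N) there exist at least two distinct values a₁ ≠ a₂ in ℝ with α(a₁) = α(a₂) = α₀; in other words, for such α₀ there exist at least two distinct radial solutions at level α₀. -/

import Mathlib

open Real Set MeasureTheory Filter

noncomputable section

/-- `u` is a radial solution of the Liouville equation
`u'' + u'/r + (1+r²)^N e^{2u} = 0` on `(0,∞)`, of class `C²` on `[0,∞)`,
with `u'(0) = 0` and finite mass `∫₀^∞ (1+r²)^N e^{2u} r dr < ∞`. -/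
def IsSol (N : ℝ) (u : ℝ → ℝ) : Prop :=
  ContDiffOn ℝ 2 u (Ici 0) ∧
  (∀ r : ℝ, 0 < r →
    deriv (deriv u) r + deriv u r / r + (1 + r ^ 2) ^ N * Real.exp (2 * u r) = 0) ∧
  derivWithin u (Ici 0) 0 = 0 ∧
  IntegrableOn (fun r => (1 + r ^ 2) ^ N * Real.exp (2 * u r) * r) (Ioi 0)

/-- `u` is a radial solution at level `α₀`: a `C²([0,∞))` solution of
`u'' + u'/r + (1+r²)^N e^{2u} = 0` on `(0,∞)` with `u'(0) = 0` and
`∫₀^∞ (1+r²)^N e^{2u} r dr = α₀`. -/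
def IsSolAtLevel (N α₀ : ℝ) (u : ℝ → ℝ) : Prop :=
  ContDiffOn ℝ 2 u (Ici 0) ∧
  (∀ r : ℝ, 0 < r →
    deriv (deriv u) r + deriv u r / r + (1 + r ^ 2) ^ N * Real.exp (2 * u r) = 0) ∧
  derivWithin u (Ici 0) 0 = 0 ∧
  IntegrableOn (fun r => (1 + r ^ 2) ^ N * Real.exp (2 * u r) * r) (Ioi 0) ∧
  (∫ r in Ioi (0:ℝ), (1 + r ^ 2) ^ N * Real.exp (2 * u r) * r) = α₀

open Topology

/-- A solution `u` of the radial equation written as a first order system, with `v = u'`. -/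
structure RadialProfile (N a : ℝ) (u v : ℝ → ℝ) : Prop where
  continuousOn_u : ContinuousOn u (Ici 0)
  continuousOn_v : ContinuousOn v (Ici 0)
  u_zero : u 0 = a
  v_zero : v 0 = 0
  hasDerivAt_u : ∀ r : ℝ, 0 < r → HasDerivAt u (v r) r
  hasDerivAt_v : ∀ r : ℝ, 0 < r →
    HasDerivAt v (-(v r / r) - (1 + r ^ 2) ^ N * Real.exp (2 * u r)) r

/-- The curvature density `(1+r²)^N e^{2u}`. -/
def density (N : ℝ) (u : ℝ → ℝ) (r : ℝ) : ℝ := (1 + r ^ 2) ^ N * Real.exp (2 * u r)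

/-- The mass `-r u'(r)` contained in the ball of radius `r`. -/
def mass (v : ℝ → ℝ) (r : ℝ) : ℝ := -(r * v r)

/-- The logarithmic derivative `r² (1+r²)^N e^{2u}` of the mass. -/
def flux (N : ℝ) (u : ℝ → ℝ) (r : ℝ) : ℝ := r ^ 2 * density N u r

/-- The compactified radius `r²/(1+r²)`. -/
def compactRadius (r : ℝ) : ℝ := r ^ 2 / (1 + r ^ 2)

/-- The moment of the mass against `compactRadius`, expressed through the Pohozaev identity. -/
def moment (N : ℝ) (u v : ℝ → ℝ) (r : ℝ) : ℝ :=
  (flux N u r - 2 * mass v r + mass v r ^ 2) / (2 * N)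

theorem le_of_hasDerivAt_nonneg {f f' : ℝ → ℝ} {x y : ℝ} (hxy : x ≤ y)
    (hf : ContinuousOn f (Icc x y)) (hf' : ∀ t ∈ Ioo x y, HasDerivAt f (f' t) t)
    (h0 : ∀ t ∈ Ioo x y, 0 ≤ f' t) : f x ≤ f y := by
  refine monotoneOn_of_hasDerivWithinAt_nonneg (f' := f') (convex_Icc x y) hf ?_ ?_
    (left_mem_Icc.2 hxy) (right_mem_Icc.2 hxy) hxy
  · intro t ht
    rw [interior_Icc] at ht
    exact (hf' t ht).hasDerivWithinAt
  · intro t ht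
    rw [interior_Icc] at ht
    exact h0 t ht

theorem compactRadius_nonneg (r : ℝ) : 0 ≤ compactRadius r := by
  unfold compactRadius; positivity

theorem compactRadius_le_one (r : ℝ) : compactRadius r ≤ 1 := by
  unfold compactRadius
  rw [div_le_one (by positivity)]
  linarith

theorem compactRadius_le_sq (r : ℝ) : compactRadius r ≤ r ^ 2 := by
  unfold compactRadius
  exact div_le_self (by positivity) (by nlinarith [sq_nonneg r])

theorem compactRadius_mono {s r : ℝ} (hs : 0 ≤ s) (hsr : s ≤ r) :
    compactRadius s ≤ compactRadius r := by
  unfold compactRadius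
  rw [div_le_div_iff₀ (by positivity) (by positivity)]
  nlinarith [pow_le_pow_left₀ hs hsr 2]

theorem hasDerivAt_compactRadius (r : ℝ) :
    HasDerivAt compactRadius (2 * r / (1 + r ^ 2) ^ 2) r := by
  have h1 : HasDerivAt (fun r : ℝ => r ^ 2) (2 * r) r := by simpa using hasDerivAt_pow 2 r
  have h := h1.div (h1.const_add 1) (by positivity)
  refine h.congr_deriv ?_
  congr 1
  ring

theorem weight_one_le {N : ℝ} (hN : 0 ≤ N) (r : ℝ) : 1 ≤ (1 + r ^ 2) ^ N :=
  Real.one_le_rpow (by nlinarith [sq_nonneg r]) hN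

theorem weight_mono {N : ℝ} (hN : 0 ≤ N) {s r : ℝ} (hs : 0 ≤ s) (hsr : s ≤ r) :
    (1 + s ^ 2) ^ N ≤ (1 + r ^ 2) ^ N :=
  Real.rpow_le_rpow (by positivity) (by nlinarith) hN

theorem density_pos (N : ℝ) (u : ℝ → ℝ) (r : ℝ) : 0 < density N u r := by
  unfold density; positivity

theorem flux_nonneg (N : ℝ) (u : ℝ → ℝ) (r : ℝ) : 0 ≤ flux N u r :=
  mul_nonneg (sq_nonneg r) (density_pos N u r).le

theorem flux_pos (N : ℝ) (u : ℝ → ℝ) {r : ℝ} (hr : 0 < r) : 0 < flux N u r :=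
  mul_pos (by positivity) (density_pos N u r)

theorem continuousOn_Icc_of_Ici {f : ℝ → ℝ} (hf : ContinuousOn f (Ici 0)) {x : ℝ} (hx : 0 ≤ x)
    (y : ℝ) : ContinuousOn f (Icc x y) :=
  hf.mono fun _ ht => hx.trans ht.1

namespace RadialProfile

variable {N a : ℝ} {u v : ℝ → ℝ}

theorem hasDerivAt_mass (h : RadialProfile N a u v) {r : ℝ} (hr : 0 < r) :
    HasDerivAt (mass v) (r * density N u r) r := by
  have h1 := ((hasDerivAt_id r).mul (h.hasDerivAt_v r hr)).neg
  refine h1.congr_deriv ?_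
  unfold density
  simp only [id_eq]
  field_simp
  ring

theorem hasDerivAt_density (h : RadialProfile N a u v) {r : ℝ} (hr : 0 < r) :
    HasDerivAt (density N u) (density N u r * (2 * N * r / (1 + r ^ 2) + 2 * v r)) r := by
  have h1 : HasDerivAt (fun r : ℝ => 1 + r ^ 2) (2 * r) r := by
    simpa using (hasDerivAt_pow 2 r).const_add 1
  have hp : (0:ℝ) < 1 + r ^ 2 := by positivity
  have h2 := h1.rpow_const (p := N) (Or.inl hp.ne')
  have h3 := (((h.hasDerivAt_u r hr).const_mul 2)).exp
  refine (h2.mul h3).congr_deriv ?_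
  unfold density
  rw [Real.rpow_sub_one hp.ne']
  field_simp

theorem hasDerivAt_flux (h : RadialProfile N a u v) {r : ℝ} (hr : 0 < r) :
    HasDerivAt (flux N u)
      (r * density N u r * (2 + 2 * N * compactRadius r - 2 * mass v r)) r := by
  have h1 : HasDerivAt (fun r : ℝ => r ^ 2) (2 * r) r := by simpa using hasDerivAt_pow 2 r
  refine (h1.mul (h.hasDerivAt_density hr)).congr_deriv ?_
  unfold compactRadius mass
  have hp : (0:ℝ) < 1 + r ^ 2 := by positivity
  field_simp
  ring

theorem hasDerivAt_moment (h : RadialProfile N a u v) (hN : 0 < N) {r : ℝ} (hr : 0 < r) :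
    HasDerivAt (moment N u v) (compactRadius r * (r * density N u r)) r := by
  have hm := h.hasDerivAt_mass hr
  have h1 := (((h.hasDerivAt_flux hr).sub (hm.const_mul 2)).add (hm.pow 2)).div_const (2 * N)
  refine h1.congr_deriv ?_
  field_simp
  ring

theorem continuousOn_mass (h : RadialProfile N a u v) : ContinuousOn (mass v) (Ici 0) :=
  (continuousOn_id.mul h.continuousOn_v).neg

theorem continuousOn_density (h : RadialProfile N a u v) :
    ContinuousOn (density N u) (Ici 0) := by
  unfold density
  refine ContinuousOn.mul ?_ (Real.continuous_exp.comp_continuousOn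
    (continuousOn_const.mul h.continuousOn_u))
  refine ContinuousOn.rpow_const (by fun_prop) fun r _ => Or.inl ?_
  positivity

theorem continuousOn_flux (h : RadialProfile N a u v) : ContinuousOn (flux N u) (Ici 0) :=
  (continuousOn_id.pow 2).mul h.continuousOn_density

theorem continuousOn_moment (h : RadialProfile N a u v) :
    ContinuousOn (moment N u v) (Ici 0) :=
  ((h.continuousOn_flux.sub (continuousOn_const.mul h.continuousOn_mass)).add
    (h.continuousOn_mass.pow 2)).div_const _

theorem mass_zero (v : ℝ → ℝ) : mass v 0 = 0 := by simp [mass]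

theorem moment_zero (N : ℝ) (u v : ℝ → ℝ) : moment N u v 0 = 0 := by
  simp [moment, flux, mass]

theorem pohozaev (hN : 0 < N) (u v : ℝ → ℝ) (r : ℝ) :
    flux N u r = 2 * mass v r - mass v r ^ 2 + 2 * N * moment N u v r := by
  unfold moment
  field_simp
  ring

theorem mass_mono (h : RadialProfile N a u v) {s r : ℝ} (hs : 0 ≤ s) (hsr : s ≤ r) :
    mass v s ≤ mass v r :=
  le_of_hasDerivAt_nonneg hsr (continuousOn_Icc_of_Ici h.continuousOn_mass hs r)
    (fun _ ht => h.hasDerivAt_mass (hs.trans_lt ht.1))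
    (fun t ht => mul_nonneg (hs.trans ht.1.le) (density_pos N u t).le)

theorem mass_nonneg (h : RadialProfile N a u v) {r : ℝ} (hr : 0 ≤ r) : 0 ≤ mass v r :=
  mass_zero v ▸ h.mass_mono le_rfl hr

theorem v_eq (v : ℝ → ℝ) {r : ℝ} (hr : 0 < r) : v r = -(mass v r / r) := by
  unfold mass
  field_simp

theorem v_nonpos (h : RadialProfile N a u v) {r : ℝ} (hr : 0 < r) : v r ≤ 0 := by
  rw [v_eq v hr]
  exact neg_nonpos.2 (div_nonneg (h.mass_nonneg hr.le) hr.le)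

theorem u_anti (h : RadialProfile N a u v) {s r : ℝ} (hs : 0 ≤ s) (hsr : s ≤ r) :
    u r ≤ u s := by
  have := le_of_hasDerivAt_nonneg (f := fun t => -u t) hsr
    (continuousOn_Icc_of_Ici h.continuousOn_u hs r).neg
    (fun t ht => (h.hasDerivAt_u t (hs.trans_lt ht.1)).neg)
    (fun t ht => neg_nonneg.2 (h.v_nonpos (hs.trans_lt ht.1)))
  simpa using this

theorem u_le (h : RadialProfile N a u v) {r : ℝ} (hr : 0 ≤ r) : u r ≤ a :=
  h.u_zero ▸ h.u_anti le_rfl hr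

/-- The increment of the moment over `[s, r]` is at least `compactRadius s` times the mass. -/
theorem moment_sub_ge (h : RadialProfile N a u v) (hN : 0 < N) {s r : ℝ} (hs : 0 ≤ s)
    (hsr : s ≤ r) :
    moment N u v s - compactRadius s * mass v s ≤ moment N u v r - compactRadius s * mass v r :=
  le_of_hasDerivAt_nonneg (f := fun t => moment N u v t - compactRadius s * mass v t) hsr
    (continuousOn_Icc_of_Ici (h.continuousOn_moment.sub
      (continuousOn_const.mul h.continuousOn_mass)) hs r)
    (fun t ht => (h.hasDerivAt_moment hN (hs.trans_lt ht.1)).sub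
      ((h.hasDerivAt_mass (hs.trans_lt ht.1)).const_mul _))
    (fun t ht => by
      rw [← sub_mul]
      exact mul_nonneg (sub_nonneg.2 (compactRadius_mono hs ht.1.le))
        (mul_nonneg (hs.trans ht.1.le) (density_pos N u t).le))

theorem moment_mono (h : RadialProfile N a u v) (hN : 0 < N) {s r : ℝ} (hs : 0 ≤ s)
    (hsr : s ≤ r) : moment N u v s ≤ moment N u v r := by
  have h1 := h.moment_sub_ge hN hs hsr
  have h2 := mul_le_mul_of_nonneg_left (h.mass_mono hs hsr) (compactRadius_nonneg s)
  linarith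

theorem moment_nonneg (h : RadialProfile N a u v) (hN : 0 < N) {r : ℝ} (hr : 0 ≤ r) :
    0 ≤ moment N u v r :=
  moment_zero N u v ▸ h.moment_mono hN le_rfl hr

theorem mass_sub_moment_mono (h : RadialProfile N a u v) (hN : 0 < N) {s r : ℝ} (hs : 0 ≤ s)
    (hsr : s ≤ r) : mass v s - moment N u v s ≤ mass v r - moment N u v r :=
  le_of_hasDerivAt_nonneg (f := fun t => mass v t - moment N u v t) hsr
    (continuousOn_Icc_of_Ici (h.continuousOn_mass.sub h.continuousOn_moment) hs r)
    (fun t ht => (h.hasDerivAt_mass (hs.trans_lt ht.1)).sub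
      (h.hasDerivAt_moment hN (hs.trans_lt ht.1)))
    (fun t ht => by
      rw [← one_sub_mul]
      exact mul_nonneg (sub_nonneg.2 (compactRadius_le_one t))
        (mul_nonneg (hs.trans ht.1.le) (density_pos N u t).le))

theorem moment_le (h : RadialProfile N a u v) (hN : 0 < N) {r : ℝ} (hr : 0 ≤ r) :
    moment N u v r ≤ compactRadius r * mass v r := by
  have := le_of_hasDerivAt_nonneg (f := fun t => compactRadius r * mass v t - moment N u v t) hr
    (continuousOn_Icc_of_Ici ((continuousOn_const.mul h.continuousOn_mass).sub
      h.continuousOn_moment) le_rfl r)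
    (fun t ht => ((h.hasDerivAt_mass ht.1).const_mul _).sub (h.hasDerivAt_moment hN ht.1))
    (fun t ht => by
      rw [← sub_mul]
      exact mul_nonneg (sub_nonneg.2 (compactRadius_mono ht.1.le ht.2.le))
        (mul_nonneg ht.1.le (density_pos N u t).le))
  simpa [mass_zero, moment_zero] using this

theorem mass_le (h : RadialProfile N a u v) (hN : 0 < N) {r : ℝ} (hr : 0 < r) :
    mass v r ≤ 2 + 2 * N * compactRadius r := by
  have h1 := h.moment_le hN hr.le
  have h2 := pohozaev hN u v r
  have h3 := flux_nonneg N u r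
  have h4 := h.mass_nonneg hr.le
  have h5 := compactRadius_nonneg r
  by_contra! hlt
  have h6 : 2 * N * moment N u v r ≤ 2 * N * (compactRadius r * mass v r) :=
    mul_le_mul_of_nonneg_left h1 (by positivity)
  have h7 : 0 < mass v r := lt_of_le_of_lt (by positivity) hlt
  nlinarith [mul_pos h7 (sub_pos.2 hlt)]

/-- Mass accumulated over `[s, r]`, bounded by the size of the density at the endpoints. -/
theorem mass_sub_le (h : RadialProfile N a u v) (hN : 0 < N) {s r : ℝ} (hs : 0 ≤ s)
    (hsr : s ≤ r) :
    mass v r - mass v s ≤ (1 + r ^ 2) ^ N * Real.exp (2 * u s) * (r ^ 2 - s ^ 2) / 2 := by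
  set C := (1 + r ^ 2) ^ N * Real.exp (2 * u s) with hC
  have := le_of_hasDerivAt_nonneg (f := fun t => C * t ^ 2 / 2 - mass v t)
    (f' := fun t => C * (2 * t) / 2 - t * density N u t) hsr
    (continuousOn_Icc_of_Ici ((by fun_prop : ContinuousOn (fun t : ℝ => C * t ^ 2 / 2) _).sub
      h.continuousOn_mass) hs r)
    (fun t ht => by
      have h1 : HasDerivAt (fun r : ℝ => r ^ 2) (2 * t) t := by simpa using hasDerivAt_pow 2 t
      exact ((h1.const_mul C).div_const 2).sub (h.hasDerivAt_mass (hs.trans_lt ht.1)))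
    (fun t ht => by
      have ht0 : 0 < t := hs.trans_lt ht.1
      have h1 : density N u t ≤ C :=
        mul_le_mul (weight_mono hN.le ht0.le ht.2.le)
          (Real.exp_le_exp.2 (by linarith [h.u_anti hs ht.1.le])) (Real.exp_pos _).le
          (by positivity)
      nlinarith)
  linarith

end RadialProfile

namespace RadialProfile

variable {N a : ℝ} {u v : ℝ → ℝ}

theorem mass_ge (h : RadialProfile N a u v) (hN : 0 < N) {r : ℝ} (hr : 0 ≤ r) :
    r ^ 2 * Real.exp (2 * u r) / 2 ≤ mass v r := by
  have := le_of_hasDerivAt_nonneg (f := fun t => mass v t - t ^ 2 * Real.exp (2 * u t) / 2)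
    (f' := fun t => t * density N u t -
      (2 * t * Real.exp (2 * u t) + t ^ 2 * (Real.exp (2 * u t) * (2 * v t))) / 2) hr
    (continuousOn_Icc_of_Ici (h.continuousOn_mass.sub (((continuousOn_id.pow 2).mul
      (Real.continuous_exp.comp_continuousOn
        (continuousOn_const.mul h.continuousOn_u))).div_const 2)) le_rfl r)
    (fun t ht => by
      have h1 : HasDerivAt (fun r : ℝ => r ^ 2) (2 * t) t := by simpa using hasDerivAt_pow 2 t
      exact (h.hasDerivAt_mass ht.1).sub
        ((h1.mul ((h.hasDerivAt_u t ht.1).const_mul 2).exp).div_const 2))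
    (fun t ht => by
      have h1 := h.v_nonpos ht.1
      have h2 : Real.exp (2 * u t) ≤ density N u t :=
        le_mul_of_one_le_left (Real.exp_pos _).le (weight_one_le hN.le t)
      have h3 : 0 ≤ t ^ 2 * (Real.exp (2 * u t) * -v t) :=
        mul_nonneg (sq_nonneg t) (mul_nonneg (Real.exp_pos _).le (neg_nonneg.2 h1))
      have h4 := mul_le_mul_of_nonneg_left h2 ht.1.le
      linarith)
  simp [mass_zero] at this
  linarith

/-- The quantity `m e^{-u} / r²` is nondecreasing. -/
theorem mass_mul_exp_div_sq_mono (h : RadialProfile N a u v) (hN : 0 < N) {s r : ℝ} (hs : 0 < s)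
    (hsr : s ≤ r) :
    mass v s * Real.exp (-u s) / s ^ 2 ≤ mass v r * Real.exp (-u r) / r ^ 2 := by
  have hpos : ∀ t ∈ Icc s r, t ^ 2 ≠ 0 := fun t ht => (pow_pos (hs.trans_le ht.1) 2).ne'
  refine le_of_hasDerivAt_nonneg (f := fun t => mass v t * Real.exp (-u t) / t ^ 2)
    (f' := fun t => Real.exp (-u t) / t ^ 3 * (2 * N * moment N u v t)) hsr
    (((continuousOn_Icc_of_Ici h.continuousOn_mass hs.le r).mul
      (Real.continuous_exp.comp_continuousOn
        (continuousOn_Icc_of_Ici h.continuousOn_u hs.le r).neg)).div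
      (by fun_prop) hpos) (fun t ht => ?_) (fun t ht => ?_)
  · have ht0 : 0 < t := hs.trans ht.1
    have h1 : HasDerivAt (fun r : ℝ => r ^ 2) (2 * t) t := by simpa using hasDerivAt_pow 2 t
    refine (((h.hasDerivAt_mass ht0).mul (h.hasDerivAt_u t ht0).neg.exp).div h1
      (by positivity)).congr_deriv ?_
    have hp := pohozaev hN u v t
    have hp' : 2 * N * moment N u v t = t ^ 2 * density N u t - 2 * mass v t + mass v t ^ 2 := by
      unfold flux at hp
      linarith
    rw [hp', v_eq v ht0]
    simp only [Pi.mul_apply, Pi.neg_apply]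
    field_simp
    ring
  · have ht0 : 0 < t := hs.trans ht.1
    have := h.moment_nonneg hN ht0.le
    positivity

theorem exp_le_mass_mul_exp_div_sq (h : RadialProfile N a u v) (hN : 0 < N) {r : ℝ}
    (hr : 0 < r) : Real.exp a / 2 ≤ mass v r * Real.exp (-u r) / r ^ 2 := by
  have hlim : Tendsto (fun s => Real.exp (u s) / 2) (𝓝[>] 0) (𝓝 (Real.exp a / 2)) := by
    have h1 : Tendsto u (𝓝[>] 0) (𝓝 a) := by
      have := h.continuousOn_u 0 self_mem_Ici
      rw [ContinuousWithinAt, h.u_zero] at this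
      exact this.mono_left (nhdsWithin_mono _ Ioi_subset_Ici_self)
    exact ((Real.continuous_exp.tendsto a).comp h1).div_const 2
  refine le_of_tendsto hlim ?_
  filter_upwards [Ioo_mem_nhdsGT hr] with s hs
  refine le_trans ?_ (h.mass_mul_exp_div_sq_mono hN hs.1 hs.2.le)
  rw [le_div_iff₀ (pow_pos hs.1 2)]
  calc Real.exp (u s) / 2 * s ^ 2
      = s ^ 2 * Real.exp (2 * u s) / 2 * Real.exp (-u s) := by
        rw [show 2 * u s = u s + u s by ring, Real.exp_add, Real.exp_neg]
        field_simp
    _ ≤ mass v s * Real.exp (-u s) :=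
        mul_le_mul_of_nonneg_right (h.mass_ge hN hs.1.le) (Real.exp_pos _).le

/-- Comparison with the spherical bubble: `e^{-u} ≥ e^a r² / 4`. -/
theorem bubble_le_exp_neg (h : RadialProfile N a u v) (hN : 0 < N) {r : ℝ} (hr : 0 ≤ r) :
    Real.exp a * r ^ 2 / 4 ≤ Real.exp (-u r) := by
  have := le_of_hasDerivAt_nonneg (f := fun t => Real.exp (-u t) - Real.exp a * t ^ 2 / 4)
    (f' := fun t => Real.exp (-u t) * (-v t) - Real.exp a * (2 * t) / 4) hr
    (continuousOn_Icc_of_Ici ((Real.continuous_exp.comp_continuousOn h.continuousOn_u.neg).sub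
      (by fun_prop)) le_rfl r)
    (fun t ht => by
      have h1 : HasDerivAt (fun r : ℝ => r ^ 2) (2 * t) t := by simpa using hasDerivAt_pow 2 t
      exact (h.hasDerivAt_u t ht.1).neg.exp.sub ((h1.const_mul _).div_const 4))
    (fun t ht => by
      have ht0 : 0 < t := ht.1
      have h1 := h.exp_le_mass_mul_exp_div_sq hN ht0
      rw [v_eq v ht0, neg_neg]
      have h2 : Real.exp (-u t) * (mass v t / t) = mass v t * Real.exp (-u t) / t ^ 2 * t := by
        field_simp
      rw [h2]
      nlinarith)
  simp at this
  linarith [Real.exp_pos (-u 0)]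

theorem exp_two_u_le (h : RadialProfile N a u v) (hN : 0 < N) {r : ℝ} (hr : 0 < r) :
    Real.exp (2 * u r) ≤ 16 * Real.exp (-(2 * a)) / r ^ 4 := by
  have h1 := h.bubble_le_exp_neg hN hr.le
  have h2 := pow_le_pow_left₀ (by positivity) h1 2
  have h3 : Real.exp (-u r) ^ 2 = (Real.exp (2 * u r))⁻¹ := by
    rw [← Real.exp_neg, ← Real.exp_nat_mul]
    congr 1
    push_cast
    ring
  have h4 : (Real.exp a * r ^ 2 / 4) ^ 2 = (16 * Real.exp (-(2 * a)) / r ^ 4)⁻¹ := by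
    rw [Real.exp_neg, show 2 * a = a + a by ring, Real.exp_add]
    field_simp
    ring
  rw [h3, h4] at h2
  exact (inv_le_inv₀ (by positivity) (Real.exp_pos _)).1 h2

/-- Upper bound for the mass in a fixed ball when the central value is large. -/
theorem mass_le_of_bubble (h : RadialProfile N a u v) (hN : 0 < N) {δ r : ℝ} (hδ : 0 < δ)
    (hr : δ ≤ r) :
    mass v r ≤ 2 + 2 * N * δ ^ 2 +
      (1 + r ^ 2) ^ N * (16 / δ ^ 4) * r ^ 2 / 2 * Real.exp (-(2 * a)) := by
  have h1 := h.mass_le hN hδ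
  have h2 := mul_le_mul_of_nonneg_left (compactRadius_le_sq δ) (by positivity : 0 ≤ 2 * N)
  have h3 := h.mass_sub_le hN hδ.le hr
  have h4 := h.exp_two_u_le hN hδ
  have h5 : (1 + r ^ 2) ^ N * Real.exp (2 * u δ) * (r ^ 2 - δ ^ 2) ≤
      (1 + r ^ 2) ^ N * (16 * Real.exp (-(2 * a)) / δ ^ 4) * r ^ 2 :=
    mul_le_mul (mul_le_mul_of_nonneg_left h4 (by positivity)) (by nlinarith)
      (by nlinarith) (by positivity)
  have h6 : (1 + r ^ 2) ^ N * (16 / δ ^ 4) * r ^ 2 / 2 * Real.exp (-(2 * a)) =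
      (1 + r ^ 2) ^ N * (16 * Real.exp (-(2 * a)) / δ ^ 4) * r ^ 2 / 2 := by ring
  linarith

section Limit

variable {α : ℝ}

theorem mass_le_limit (h : RadialProfile N a u v) (hα : Tendsto (mass v) atTop (𝓝 α)) {r : ℝ}
    (hr : 0 ≤ r) : mass v r ≤ α :=
  ge_of_tendsto hα ((eventually_ge_atTop r).mono fun _ ht => h.mass_mono hr ht)

theorem exists_moment_tendsto (h : RadialProfile N a u v) (hN : 0 < N)
    (hα : Tendsto (mass v) atTop (𝓝 α)) : ∃ J, Tendsto (moment N u v) atTop (𝓝 J) := by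
  have hmono : Monotone fun r => moment N u v (max r 0) := fun s r hsr =>
    h.moment_mono hN (le_max_right _ _) (max_le_max hsr le_rfl)
  have hbdd : BddAbove (range fun r => moment N u v (max r 0)) := by
    refine ⟨α, ?_⟩
    rintro _ ⟨r, rfl⟩
    have h0 : 0 ≤ max r 0 := le_max_right _ _
    have h1 := h.moment_le hN h0
    have h2 := mul_le_mul_of_nonneg_right (compactRadius_le_one (max r 0)) (h.mass_nonneg h0)
    have h3 := h.mass_le_limit hα h0
    simp only
    linarith
  refine ⟨_, (tendsto_atTop_ciSup hmono hbdd).congr' ?_⟩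
  filter_upwards [eventually_ge_atTop 0] with r hr
  rw [max_eq_left hr]

theorem flux_tendsto_zero (h : RadialProfile N a u v) (hN : 0 < N)
    (hα : Tendsto (mass v) atTop (𝓝 α)) : Tendsto (flux N u) atTop (𝓝 0) := by
  obtain ⟨J, hJ⟩ := h.exists_moment_tendsto hN hα
  have hlim : Tendsto (flux N u) atTop (𝓝 (2 * α - α ^ 2 + 2 * N * J)) :=
    (((hα.const_mul 2).sub (hα.pow 2)).add (hJ.const_mul (2 * N))).congr
      fun r => (pohozaev hN u v r).symm
  set L := 2 * α - α ^ 2 + 2 * N * J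
  have hL0 : 0 ≤ L := ge_of_tendsto' hlim fun r => flux_nonneg N u r
  rcases hL0.eq_or_lt with hL | hL
  · rwa [← hL] at hlim
  exfalso
  obtain ⟨R, hR⟩ := eventually_atTop.1 (hlim.eventually (lt_mem_nhds (half_lt_self hL)))
  set S := max R 1
  have hS : 0 < S := lt_of_lt_of_le one_pos (le_max_right _ _)
  have hgrow : ∀ r, S ≤ r → mass v S - L / 2 * Real.log S ≤ mass v r - L / 2 * Real.log r :=
    fun r hr => le_of_hasDerivAt_nonneg (f := fun t => mass v t - L / 2 * Real.log t) hr
      ((continuousOn_Icc_of_Ici h.continuousOn_mass hS.le r).sub (continuousOn_const.mul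
        (Real.continuousOn_log.mono fun t ht => (hS.trans_le ht.1).ne')))
      (fun t ht => (h.hasDerivAt_mass (hS.trans ht.1)).sub
        ((Real.hasDerivAt_log (hS.trans ht.1).ne').const_mul _))
      (fun t ht => by
        have ht0 : 0 < t := hS.trans ht.1
        have h1 := (hR t ((le_max_left _ _).trans ht.1.le)).le
        have h2 : t * density N u t = flux N u t * t⁻¹ := by
          unfold flux
          field_simp
        rw [h2, ← sub_mul]
        exact mul_nonneg (sub_nonneg.2 h1) (inv_nonneg.2 ht0.le))
  have htop : Tendsto (fun r => mass v S - L / 2 * Real.log S + L / 2 * Real.log r) atTop atTop :=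
    tendsto_atTop_add_const_left _ _ (Real.tendsto_log_atTop.const_mul_atTop (half_pos hL))
  obtain ⟨r, hr1, hr2⟩ := ((htop.eventually_gt_atTop α).and (eventually_ge_atTop S)).exists
  have := hgrow r hr2
  have := h.mass_le_limit hα (hS.le.trans hr2)
  linarith

/-- The Pohozaev identity in the limit. -/
theorem moment_tendsto (h : RadialProfile N a u v) (hN : 0 < N)
    (hα : Tendsto (mass v) atTop (𝓝 α)) :
    Tendsto (moment N u v) atTop (𝓝 ((α ^ 2 - 2 * α) / (2 * N))) := by
  have := ((((h.flux_tendsto_zero hN hα).sub (hα.const_mul 2)).add (hα.pow 2)).div_const (2 * N))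
  rwa [zero_sub, neg_add_eq_sub] at this

theorem lt_limit (h : RadialProfile N a u v) (hN : 0 < N)
    (hα : Tendsto (mass v) atTop (𝓝 α)) : N + 1 < α := by
  by_contra! hle
  set g : ℝ → ℝ := fun r => u r + (N + 1) * Real.log r
  have hmono : ∀ r, 1 ≤ r → g 1 ≤ g r := fun r hr => le_of_hasDerivAt_nonneg hr
    ((continuousOn_Icc_of_Ici h.continuousOn_u zero_le_one r).add (continuousOn_const.mul
      (Real.continuousOn_log.mono fun t ht => (one_pos.trans_le ht.1).ne')))
    (fun t ht => (h.hasDerivAt_u t (one_pos.trans ht.1)).add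
      ((Real.hasDerivAt_log (one_pos.trans ht.1).ne').const_mul _))
    (fun t ht => by
      have ht0 : 0 < t := one_pos.trans ht.1
      rw [v_eq v ht0]
      have h1 := h.mass_le_limit hα ht0.le
      have h2 : -(mass v t / t) + (N + 1) * t⁻¹ = (N + 1 - mass v t) * t⁻¹ := by
        field_simp
        ring
      rw [h2]
      exact mul_nonneg (by linarith) (inv_nonneg.2 ht0.le))
  have hlow : ∀ r, 1 ≤ r → Real.exp (2 * g 1) ≤ flux N u r := fun r hr => by
    have hr0 : 0 < r := one_pos.trans_le hr
    calc Real.exp (2 * g 1) ≤ Real.exp (2 * g r) := Real.exp_le_exp.2 (by linarith [hmono r hr])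
      _ = r ^ 2 * ((r ^ 2) ^ N * Real.exp (2 * u r)) := by
        have h1 : 2 * g r = Real.log r * 2 + Real.log (r ^ 2) * N + 2 * u r := by
          simp only [g, Real.log_pow]
          push_cast
          ring
        rw [h1, Real.exp_add, Real.exp_add, ← Real.rpow_def_of_pos (by positivity),
          ← Real.rpow_def_of_pos (by positivity), Real.rpow_ofNat]
        ring
      _ ≤ flux N u r := by
        unfold flux density
        gcongr
        linarith
  have := ge_of_tendsto (h.flux_tendsto_zero hN hα) ((eventually_ge_atTop 1).mono hlow)
  exact absurd this (not_le.2 (Real.exp_pos _))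

theorem limit_le_of_flux (h : RadialProfile N a u v) (hN : 0 < N)
    (hα : Tendsto (mass v) atTop (𝓝 α)) {r : ℝ} (hr : 0 ≤ r) (hm : N + 1 < mass v r) :
    α ≤ mass v r + flux N u r / (2 * (mass v r - (N + 1))) := by
  set c := 2 * (mass v r - (N + 1)) with hc
  have hc0 : 0 < c := by linarith
  have hmono : ∀ t, r ≤ t → c * mass v t + flux N u t ≤ c * mass v r + flux N u r := by
    intro t ht
    have := le_of_hasDerivAt_nonneg (f := fun t => -(c * mass v t + flux N u t)) ht
      (continuousOn_Icc_of_Ici ((continuousOn_const.mul h.continuousOn_mass).add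
        h.continuousOn_flux).neg hr t)
      (fun s hs => (((h.hasDerivAt_mass (hr.trans_lt hs.1)).const_mul c).add
        (h.hasDerivAt_flux (hr.trans_lt hs.1))).neg)
      (fun s hs => by
        have h1 := h.mass_mono hr hs.1.le
        have h2 := compactRadius_le_one s
        have h3 := mul_le_mul_of_nonneg_left h2 hN.le
        have h4 : -(c * (s * density N u s) + s * density N u s *
            (2 + 2 * N * compactRadius s - 2 * mass v s)) = s * density N u s *
            (2 * mass v s - 2 - 2 * N * compactRadius s - c) := by ring
        rw [h4]
        exact mul_nonneg (mul_nonneg (hr.trans hs.1.le) (density_pos N u s).le) (by linarith))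
    exact neg_le_neg_iff.1 this
  have hlim := (hα.const_mul c).add (h.flux_tendsto_zero hN hα)
  have := le_of_tendsto hlim ((eventually_ge_atTop r).mono hmono)
  rw [← sub_le_iff_le_add', le_div_iff₀ hc0]
  linarith

theorem pohozaev_limit_ge (h : RadialProfile N a u v) (hN : 0 < N)
    (hα : Tendsto (mass v) atTop (𝓝 α)) {r : ℝ} (hr : 0 ≤ r) :
    2 * N * compactRadius r * (α - mass v r) ≤ α ^ 2 - 2 * α := by
  have hlim := (h.moment_tendsto hN hα).sub (hα.const_mul (compactRadius r))
  have h1 := ge_of_tendsto hlim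
    ((eventually_ge_atTop r).mono fun t ht => h.moment_sub_ge hN hr ht)
  have h2 := h.moment_nonneg hN hr
  have h3 : compactRadius r * (α - mass v r) ≤ (α ^ 2 - 2 * α) / (2 * N) := by linarith
  rw [le_div_iff₀ (by positivity)] at h3
  linarith

/-- If the mass of a ball weighted by `1/(1+r²)` exceeds `2`, then the total mass is below `2N`. -/
theorem limit_lt_two_mul (h : RadialProfile N a u v) (hN : 1 < N)
    (hα : Tendsto (mass v) atTop (𝓝 α)) {r : ℝ} (hr : 0 ≤ r)
    (hm : 2 < mass v r - moment N u v r) : α < 2 * N := by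
  have hN0 : 0 < N := one_pos.trans hN
  have h1 := ge_of_tendsto (hα.sub (h.moment_tendsto hN0 hα))
    ((eventually_ge_atTop r).mono fun t ht => h.mass_sub_moment_mono hN0 hr ht)
  have h2 := h.lt_limit hN0 hα
  have h3 : (α ^ 2 - 2 * α) / (2 * N) < α - 2 := by linarith
  rw [div_lt_iff₀ (by positivity)] at h3
  nlinarith

end Limit

end RadialProfile

namespace RadialProfile

variable {N a : ℝ} {u v : ℝ → ℝ}

theorem weight_le_two_rpow {N : ℝ} (hN : 0 ≤ N) {r : ℝ} (hr : 0 ≤ r) (hr1 : r ≤ 1) :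
    (1 + r ^ 2) ^ N ≤ 2 ^ N := by
  have := weight_mono hN hr hr1
  norm_num at this
  exact this

theorem u_ge (h : RadialProfile N a u v) (hN : 0 < N) {r : ℝ} (hr : 0 ≤ r) (hr1 : r ≤ 1) :
    a - 2 ^ N * Real.exp (2 * a) * r ^ 2 / 4 ≤ u r := by
  have := le_of_hasDerivAt_nonneg (f := fun t => u t + 2 ^ N * Real.exp (2 * a) * t ^ 2 / 4)
    (f' := fun t => v t + 2 ^ N * Real.exp (2 * a) * (2 * t) / 4) hr
    (continuousOn_Icc_of_Ici (h.continuousOn_u.add (by fun_prop)) le_rfl r)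
    (fun t ht => by
      have h1 : HasDerivAt (fun r : ℝ => r ^ 2) (2 * t) t := by simpa using hasDerivAt_pow 2 t
      exact (h.hasDerivAt_u t ht.1).add ((h1.const_mul _).div_const 4))
    (fun t ht => by
      have ht0 : 0 < t := ht.1
      have h1 := h.mass_sub_le hN le_rfl ht0.le
      rw [mass_zero, h.u_zero] at h1
      have h2 := mul_le_mul_of_nonneg_right (weight_le_two_rpow hN.le ht0.le (ht.2.le.trans hr1))
        (by positivity : 0 ≤ Real.exp (2 * a) * t ^ 2)
      have h3 : mass v t / t ≤ 2 ^ N * Real.exp (2 * a) * (2 * t) / 4 := by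
        rw [div_le_iff₀ ht0]
        linarith
      rw [v_eq v ht0]
      linarith)
  simp [h.u_zero] at this
  linarith

theorem u_add_log_mono (h : RadialProfile N a u v) (hN : 0 < N) {s r : ℝ} (hs : 0 < s)
    (hsr : s ≤ r) :
    u s + 2 * Real.log s + N * Real.log (1 + s ^ 2) ≤
      u r + 2 * Real.log r + N * Real.log (1 + r ^ 2) := by
  refine le_of_hasDerivAt_nonneg (f := fun t => u t + 2 * Real.log t + N * Real.log (1 + t ^ 2))
    (f' := fun t => v t + 2 * t⁻¹ + N * (2 * t / (1 + t ^ 2))) hsr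
    (((continuousOn_Icc_of_Ici h.continuousOn_u hs.le r).add (continuousOn_const.mul
      (Real.continuousOn_log.mono fun t ht => (hs.trans_le ht.1).ne'))).add
      (continuousOn_const.mul (ContinuousOn.log (by fun_prop) fun t _ => by positivity)))
    (fun t ht => ?_) (fun t ht => ?_)
  · have ht0 : 0 < t := hs.trans ht.1
    have h1 : HasDerivAt (fun r : ℝ => 1 + r ^ 2) (2 * t) t := by
      simpa using (hasDerivAt_pow 2 t).const_add 1
    exact ((h.hasDerivAt_u t ht0).add ((Real.hasDerivAt_log ht0.ne').const_mul 2)).add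
      ((h1.log (by positivity)).const_mul N)
  · have ht0 : 0 < t := hs.trans ht.1
    have h1 := h.mass_le hN ht0
    rw [v_eq v ht0]
    have h2 : -(mass v t / t) + 2 * t⁻¹ + N * (2 * t / (1 + t ^ 2)) =
        (2 + 2 * N * compactRadius t - mass v t) / t := by
      unfold compactRadius
      field_simp
      ring
    rw [h2]
    exact div_nonneg (by linarith) ht0.le

/-- After the first bubble, the moment is at least of order `a e^{-2a}`. -/
theorem moment_ge (h : RadialProfile N a u v) (hN : 0 < N) (ha : 0 ≤ a) {r : ℝ}
    (har : Real.exp (-a) ≤ r) (hr1 : r ≤ 1) :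
    Real.exp (-(2 ^ N / 2) - 2 * N * Real.log 2) / 2 * Real.exp (-(2 * a)) * (Real.log r + a) ≤
      moment N u v r := by
  set ε := Real.exp (-a) with hε
  have hε0 : 0 < ε := Real.exp_pos _
  have hε1 : ε ≤ 1 := Real.exp_le_one_iff.2 (by linarith)
  set c := Real.exp (-(2 ^ N / 2) - 2 * N * Real.log 2) / 2 * Real.exp (-(2 * a)) with hc
  have hlogε : Real.log ε = -a := Real.log_exp _
  have huε : a - 2 ^ N / 4 ≤ u ε := by
    have h1 := h.u_ge hN hε0.le hε1
    have h2 : Real.exp (2 * a) * ε ^ 2 = 1 := by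
      rw [hε, ← Real.exp_nat_mul, ← Real.exp_add]
      simp
    rw [mul_assoc, h2, mul_one] at h1
    exact h1
  have key : ∀ t ∈ Ioo ε r, c ≤ compactRadius t * (t * density N u t) * t := by
    intro t ht
    have ht0 : 0 < t := hε0.trans ht.1
    have ht1 : t ≤ 1 := ht.2.le.trans hr1
    have h1 := h.u_add_log_mono hN hε0 ht.1.le
    have h2 : 0 ≤ N * Real.log (1 + ε ^ 2) :=
      mul_nonneg hN.le (Real.log_nonneg (by nlinarith))
    have h3 : N * Real.log (1 + t ^ 2) ≤ N * Real.log 2 :=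
      mul_le_mul_of_nonneg_left (Real.log_le_log (by positivity) (by nlinarith)) hN.le
    rw [hlogε] at h1
    have h4 : -(2 ^ N / 2) - 2 * N * Real.log 2 + -(2 * a) ≤ 2 * u t + Real.log t * 4 := by
      linarith
    calc c = Real.exp (-(2 ^ N / 2) - 2 * N * Real.log 2 + -(2 * a)) / 2 := by
          rw [hc, Real.exp_add]
          ring
      _ ≤ Real.exp (2 * u t + Real.log t * 4) / 2 := by gcongr
      _ = t ^ 2 / 2 * (t * (1 * Real.exp (2 * u t))) * t := by
          rw [Real.exp_add, ← Real.rpow_def_of_pos ht0, Real.rpow_ofNat]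
          ring
      _ ≤ compactRadius t * (t * density N u t) * t := by
          unfold compactRadius density
          have h5 := weight_one_le hN.le t
          have h6 : 1 + t ^ 2 ≤ 2 := by nlinarith
          gcongr
  have := le_of_hasDerivAt_nonneg (f := fun t => moment N u v t - c * Real.log t) har
    ((continuousOn_Icc_of_Ici h.continuousOn_moment hε0.le r).sub (continuousOn_const.mul
      (Real.continuousOn_log.mono fun t ht => (hε0.trans_le ht.1).ne')))
    (fun t ht => (h.hasDerivAt_moment hN (hε0.trans ht.1)).sub
      ((Real.hasDerivAt_log (hε0.trans ht.1).ne').const_mul _))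
    (fun t ht => by
      have ht0 : 0 < t := hε0.trans ht.1
      rw [← div_eq_mul_inv, sub_nonneg, div_le_iff₀ ht0]
      exact key t ht)
  simp only [hlogε] at this
  have := h.moment_nonneg hN hε0.le
  linarith

end RadialProfile

/-- For large central values the total mass is below `2N`. -/
theorem exists_forall_ge_limit_lt {N : ℝ} (hN : 1 < N) :
    ∃ A : ℝ, ∀ a ≥ A, ∀ (u v : ℝ → ℝ) (α : ℝ), RadialProfile N a u v →
      Tendsto (mass v) atTop (𝓝 α) → α < 2 * N := by
  have hN0 : 0 < N := one_pos.trans hN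
  set R := √((N - 1) / (2 + 2 * N)) with hR
  have hRsq : R ^ 2 = (N - 1) / (2 + 2 * N) :=
    Real.sq_sqrt (div_nonneg (by linarith) (by linarith))
  have hR0 : 0 < R := Real.sqrt_pos.2 (div_pos (by linarith) (by linarith))
  have hR1 : R ≤ 1 := by
    refine Real.sqrt_le_one.2 ?_
    rw [div_le_one (by linarith)]
    linarith
  set κ := Real.exp (-(2 ^ N / 2) - 2 * N * Real.log 2) / 2 with hκ
  have hκ0 : 0 < κ := by positivity
  set B := R ^ 2 * (2 ^ N * (16 / R ^ 4)) with hB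
  refine ⟨max (max 0 (-Real.log R)) (B / ((N - 1) * κ) - Real.log R + 1), ?_⟩
  intro a ha u v α h hα
  have ha0 : 0 ≤ a := (le_max_left _ _).trans ((le_max_left _ _).trans ha)
  have ha1 : -Real.log R ≤ a := (le_max_right _ _).trans ((le_max_left _ _).trans ha)
  have ha2 : B / ((N - 1) * κ) - Real.log R + 1 ≤ a := (le_max_right _ _).trans ha
  refine h.limit_lt_two_mul hN hα hR0.le ?_
  by_contra! hle
  have haR : Real.exp (-a) ≤ R := by
    rw [← Real.le_log_iff_exp_le hR0]
    linarith
  have hJ := h.moment_ge hN0 ha0 haR hR1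
  have hJ0 := h.moment_nonneg hN0 hR0.le
  have hm0 := h.mass_nonneg hR0.le
  have hp := RadialProfile.pohozaev hN0 u v R
  have hJle : moment N u v R ≤ N - 1 := by
    have h1 := h.moment_le hN0 hR0.le
    have h2 := h.mass_le hN0 hR0
    have h3 := mul_le_mul_of_nonneg_left (compactRadius_le_one R) (by positivity : 0 ≤ 2 * N)
    have h4 : compactRadius R * mass v R ≤ R ^ 2 * (2 + 2 * N) :=
      mul_le_mul (compactRadius_le_sq R) (by linarith) hm0 (by positivity)
    rw [hRsq, div_mul_cancel₀ _ (by linarith)] at h4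
    linarith
  have hflux : flux N u R ≤ B * Real.exp (-(2 * a)) := by
    have h1 := h.exp_two_u_le hN0 hR0
    have h2 : flux N u R ≤ R ^ 2 * (2 ^ N * (16 * Real.exp (-(2 * a)) / R ^ 4)) :=
      mul_le_mul_of_nonneg_left (mul_le_mul (RadialProfile.weight_le_two_rpow hN0.le hR0.le hR1)
        h1 (Real.exp_pos _).le (by positivity)) (sq_nonneg R)
    refine h2.trans_eq ?_
    rw [hB]
    ring
  set m := mass v R
  set J := moment N u v R
  have h1 : (N - 1) * J ≤ flux N u R := by
    nlinarith [mul_nonneg (by linarith : 0 ≤ 2 + J - m) (add_nonneg hJ0 hm0),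
      mul_nonneg hJ0 (sub_nonneg.2 hJle)]
  have hN1 : 0 < N - 1 := by linarith
  have h2 := mul_le_mul_of_nonneg_left hJ hN1.le
  rw [← hκ] at h2
  have h3 : (N - 1) * κ * (Real.log R + a) * Real.exp (-(2 * a)) ≤ B * Real.exp (-(2 * a)) := by
    linarith
  have h4 := le_of_mul_le_mul_right h3 (Real.exp_pos _)
  rw [mul_comm, ← le_div_iff₀ (by positivity)] at h4
  linarith

/-- For large central values the total mass exceeds any number below `2N`. -/
theorem exists_forall_ge_lt_limit {N α₀ : ℝ} (hN : 1 < N) (hα₀ : α₀ < 2 * N) :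
    ∃ A : ℝ, ∀ a ≥ A, ∀ (u v : ℝ → ℝ) (α : ℝ), RadialProfile N a u v →
      Tendsto (mass v) atTop (𝓝 α) → α₀ < α := by
  have hN0 : 0 < N := one_pos.trans hN
  have hd : 0 < 2 * N - α₀ := by linarith
  set R := 1 + 4 * N / (2 * N - α₀) with hR
  have hR1 : 1 ≤ R := le_add_of_nonneg_right (by positivity)
  have hρ : (2 * N + α₀) / 2 ≤ 2 * N * compactRadius R := by
    have h1 : 4 * N / (2 * N - α₀) ≤ 1 + R ^ 2 := by nlinarith
    rw [div_le_iff₀ hd] at h1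
    unfold compactRadius
    rw [← mul_div_assoc, le_div_iff₀ (by positivity)]
    linarith
  set ε := (2 * N - α₀) * (N - 1) / (4 * N) with hε
  have hε0 : 0 < ε := div_pos (mul_pos hd (by linarith)) (by linarith)
  set δ := min 1 (ε / (4 * N)) with hδ
  have hδ0 : 0 < δ := lt_min one_pos (by positivity)
  have hδ1 : δ ≤ 1 := min_le_left _ _
  have hδε : 2 * N * δ ^ 2 ≤ ε / 2 := by
    have h1 : δ ≤ ε / (4 * N) := min_le_right _ _
    rw [le_div_iff₀ (by positivity)] at h1
    nlinarith
  set C := (1 + R ^ 2) ^ N * (16 / δ ^ 4) * R ^ 2 / 2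
  have hlim : Tendsto (fun a : ℝ => C * Real.exp (-(2 * a))) atTop (𝓝 (C * 0)) :=
    (Real.tendsto_exp_neg_atTop_nhds_zero.comp
      (tendsto_id.const_mul_atTop two_pos)).const_mul C
  rw [mul_zero] at hlim
  obtain ⟨A, hA⟩ := eventually_atTop.1 (hlim.eventually (gt_mem_nhds (half_pos hε0)))
  refine ⟨A, fun a ha u v α h hα => ?_⟩
  by_contra! hle
  have h1 : mass v R ≤ 2 + 2 * N * δ ^ 2 + C * Real.exp (-(2 * a)) :=
    h.mass_le_of_bubble hN0 hδ0 (hδ1.trans hR1)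
  have h2 := hA a ha
  have h3 := h.pohozaev_limit_ge hN0 hα (zero_le_one.trans hR1)
  have h4 := h.lt_limit hN0 hα
  have h5 : mass v R ≤ 2 + ε := by linarith
  have hq0 : 0 ≤ 2 * N * compactRadius R := mul_nonneg (by linarith) (compactRadius_nonneg R)
  have h6 := mul_le_mul_of_nonneg_left (compactRadius_le_one R) (by positivity : 0 ≤ 2 * N)
  set q := 2 * N * compactRadius R
  have h7 : q * (α - (2 + ε)) ≤ α ^ 2 - 2 * α :=
    (mul_le_mul_of_nonneg_left (by linarith) hq0).trans h3
  have h8 : (q - α) * (α - 2) ≤ 2 * N * ε := by nlinarith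
  have h9 : (2 * N - α₀) / 2 * (α - 2) ≤ (q - α) * (α - 2) :=
    mul_le_mul_of_nonneg_right (by linarith) (by linarith)
  have h10 : (2 * N - α₀) / 2 * (N - 1) < (2 * N - α₀) / 2 * (α - 2) :=
    mul_lt_mul_of_pos_left (by linarith) (by linarith)
  have h11 : 2 * N * ε = (2 * N - α₀) / 2 * (N - 1) := by
    rw [hε]
    field_simp
    ring
  linarith

/-- For very negative central values the total mass exceeds `2N`. -/
theorem exists_forall_le_lt_limit {N : ℝ} (hN : 1 < N) :
    ∃ B : ℝ, ∀ a ≤ B, ∀ (u v : ℝ → ℝ) (α : ℝ), RadialProfile N a u v →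
      Tendsto (mass v) atTop (𝓝 α) → 2 * N < α := by
  have hN0 : 0 < N := one_pos.trans hN
  set C := (1 + √N ^ 2) ^ N * √N ^ 2 / 2
  have hlim : Tendsto (fun a : ℝ => C * Real.exp (2 * a)) atBot (𝓝 (C * 0)) :=
    (Real.tendsto_exp_atBot.comp (tendsto_id.const_mul_atBot two_pos)).const_mul C
  rw [mul_zero] at hlim
  have hpos : 0 < 1 / N ^ 2 := by positivity
  obtain ⟨B, hB⟩ := eventually_atBot.1 (hlim.eventually (gt_mem_nhds hpos))
  refine ⟨B, fun a ha u v α h hα => ?_⟩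
  have h1 := h.mass_sub_le hN0 le_rfl (Real.sqrt_nonneg N)
  rw [RadialProfile.mass_zero, h.u_zero] at h1
  have h2 := hB a ha
  have h3 : mass v √N < 1 / N ^ 2 := by
    refine lt_of_le_of_lt ?_ h2
    simp only [C]
    linarith
  have h4 := h.pohozaev_limit_ge hN0 hα (Real.sqrt_nonneg N)
  have h5 := h.lt_limit hN0 hα
  have h6 : compactRadius √N = N / (1 + N) := by
    rw [compactRadius, Real.sq_sqrt hN0.le]
  rw [h6] at h4
  have h7 : α * (1 - 1 / N ^ 2) < α - mass v √N := by nlinarith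
  have h8 : 2 * N * (N / (1 + N)) * (α * (1 - 1 / N ^ 2)) < α ^ 2 - 2 * α :=
    (mul_lt_mul_of_pos_left h7 (by positivity)).trans_le h4
  have h9 : 2 * N * (N / (1 + N)) * (α * (1 - 1 / N ^ 2)) = α * (2 * (N - 1)) := by
    field_simp
    ring
  rw [h9, show α ^ 2 - 2 * α = α * (α - 2) by ring] at h8
  have := lt_of_mul_lt_mul_left h8 (by linarith)
  linarith

/-- Continuous dependence on the central value. -/
theorem RadialProfile.sq_sub_add_sq_sub_le {N a b A : ℝ} {u v y z : ℝ → ℝ}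
    (hu : RadialProfile N a u v) (hy : RadialProfile N b y z) (hN : 0 < N) (ha : a ≤ A)
    (hb : b ≤ A) {r : ℝ} (hr : 0 ≤ r) :
    (u r - y r) ^ 2 + (v r - z r) ^ 2 ≤
      (a - b) ^ 2 * Real.exp ((1 + 2 * (1 + r ^ 2) ^ N * Real.exp (2 * A)) * r) := by
  set C := 1 + 2 * (1 + r ^ 2) ^ N * Real.exp (2 * A) with hC
  have := le_of_hasDerivAt_nonneg
    (f := fun t => -(((u t - y t) ^ 2 + (v t - z t) ^ 2) * Real.exp (-C * t)))
    (f' := fun t => Real.exp (-C * t) * (C * ((u t - y t) ^ 2 + (v t - z t) ^ 2) -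
      2 * (u t - y t) * (v t - z t) + 2 * (v t - z t) ^ 2 / t +
      2 * (v t - z t) * (density N u t - density N y t))) hr
    (continuousOn_Icc_of_Ici ((((hu.continuousOn_u.sub hy.continuousOn_u).pow 2).add
      ((hu.continuousOn_v.sub hy.continuousOn_v).pow 2)).mul (by fun_prop)).neg le_rfl r)
    (fun t ht => by
      have ht0 : 0 < t := ht.1
      have h1 : HasDerivAt (fun t => -C * t) (-C) t := by
        simpa using (hasDerivAt_id t).const_mul (-C)
      refine ((((((hu.hasDerivAt_u t ht0).sub (hy.hasDerivAt_u t ht0)).pow 2).add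
        (((hu.hasDerivAt_v t ht0).sub (hy.hasDerivAt_v t ht0)).pow 2)).mul h1.exp).neg
        ).congr_deriv ?_
      simp only [Pi.sub_apply, Pi.add_apply, Pi.pow_apply]
      unfold density
      field_simp
      ring)
    (fun t ht => by
      have ht0 : 0 < t := ht.1
      refine mul_nonneg (Real.exp_pos _).le ?_
      have hexp : |Real.exp (2 * u t) - Real.exp (2 * y t)| ≤
          2 * Real.exp (2 * A) * |u t - y t| := by
        have hLip := (convex_Iic A).norm_image_sub_le_of_norm_hasDerivWithin_le
          (f := fun x => Real.exp (2 * x)) (f' := fun x => Real.exp (2 * x) * 2)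
          (C := 2 * Real.exp (2 * A))
          (fun x _ => by
            have h1 : HasDerivAt (fun x : ℝ => 2 * x) 2 x := by
              simpa using (hasDerivAt_id x).const_mul 2
            exact h1.exp.hasDerivWithinAt)
          (fun x hx => by
            rw [Real.norm_eq_abs, abs_of_pos (by positivity), mul_comm]
            have : Real.exp (2 * x) ≤ Real.exp (2 * A) :=
              Real.exp_le_exp.2 (by linarith [mem_Iic.1 hx])
            linarith)
          (mem_Iic.2 ((hy.u_le ht0.le).trans hb)) (mem_Iic.2 ((hu.u_le ht0.le).trans ha))
        simpa [Real.norm_eq_abs] using hLip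
      have hd : |density N u t - density N y t| ≤ (C - 1) * |u t - y t| := by
        unfold density
        rw [← mul_sub, abs_mul, abs_of_pos (by positivity)]
        calc (1 + t ^ 2) ^ N * |Real.exp (2 * u t) - Real.exp (2 * y t)|
            ≤ (1 + r ^ 2) ^ N * (2 * Real.exp (2 * A) * |u t - y t|) :=
              mul_le_mul (weight_mono hN.le ht0.le ht.2.le) hexp (abs_nonneg _) (by positivity)
          _ = (C - 1) * |u t - y t| := by
              rw [hC]
              ring
      set w := u t - y t
      set q := v t - z t
      set d := density N u t - density N y t
      have h1 : 0 ≤ 2 * q ^ 2 / t := by positivity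
      have h2 : |q * d| ≤ (C - 1) * (|w| * |q|) := by
        rw [abs_mul]
        nlinarith [mul_le_mul_of_nonneg_left hd (abs_nonneg q)]
      have h3 := neg_abs_le (q * d)
      have h4 : w * q ≤ |w| * |q| := by
        rw [← abs_mul]
        exact le_abs_self _
      have hC1 : 0 ≤ C := by positivity
      have h5 : 0 ≤ C * (|w| - |q|) ^ 2 := by positivity
      have h6 : (|w| - |q|) ^ 2 = w ^ 2 + q ^ 2 - 2 * (|w| * |q|) := by
        rw [sub_sq, sq_abs, sq_abs]
        ring
      rw [h6] at h5
      nlinarith)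
  simp only [hu.u_zero, hy.u_zero, hu.v_zero, hy.v_zero] at this
  have h1 : ((u r - y r) ^ 2 + (v r - z r) ^ 2) * Real.exp (-C * r) ≤ (a - b) ^ 2 := by
    simpa using this
  rw [neg_mul, Real.exp_neg, ← div_eq_mul_inv, div_le_iff₀ (Real.exp_pos _)] at h1
  exact h1

section Family

variable {N : ℝ} {u v : ℝ → ℝ → ℝ} {α : ℝ → ℝ}

theorem tendsto_sq_sub_add_sq_sub (hN : 0 < N) (h : ∀ a, RadialProfile N a (u a) (v a))
    (a : ℝ) {r : ℝ} (hr : 0 ≤ r) :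
    Tendsto (fun b => (u b r - u a r) ^ 2 + (v b r - v a r) ^ 2) (𝓝 a) (𝓝 0) := by
  set E := Real.exp ((1 + 2 * (1 + r ^ 2) ^ N * Real.exp (2 * (a + 1))) * r)
  have hlim : Tendsto (fun b => (b - a) ^ 2 * E) (𝓝 a) (𝓝 0) := by
    have : ContinuousAt (fun b => (b - a) ^ 2 * E) a := by fun_prop
    simpa [ContinuousAt] using this
  refine tendsto_of_tendsto_of_tendsto_of_le_of_le' tendsto_const_nhds hlim
    (Eventually.of_forall fun b => by positivity) ?_
  filter_upwards [gt_mem_nhds (lt_add_one a)] with b hb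
  exact (h b).sq_sub_add_sq_sub_le (h a) hN hb.le (lt_add_one a).le hr

theorem continuousAt_of_sq_sub_tendsto {f : ℝ → ℝ} {a : ℝ}
    (hf : Tendsto (fun b => (f b - f a) ^ 2) (𝓝 a) (𝓝 0)) : ContinuousAt f a := by
  have h1 := (Real.continuous_sqrt.tendsto 0).comp hf
  rw [Real.sqrt_zero] at h1
  rw [ContinuousAt, tendsto_iff_norm_sub_tendsto_zero]
  refine h1.congr fun b => ?_
  rw [Function.comp_apply, Real.sqrt_sq_eq_abs, Real.norm_eq_abs]

theorem continuous_u_param (hN : 0 < N) (h : ∀ a, RadialProfile N a (u a) (v a)) {r : ℝ}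
    (hr : 0 ≤ r) : Continuous fun a => u a r :=
  continuous_iff_continuousAt.2 fun a => continuousAt_of_sq_sub_tendsto <|
    squeeze_zero (fun _ => sq_nonneg _) (fun _ => le_add_of_nonneg_right (sq_nonneg _))
      (tendsto_sq_sub_add_sq_sub hN h a hr)

theorem continuous_v_param (hN : 0 < N) (h : ∀ a, RadialProfile N a (u a) (v a)) {r : ℝ}
    (hr : 0 ≤ r) : Continuous fun a => v a r :=
  continuous_iff_continuousAt.2 fun a => continuousAt_of_sq_sub_tendsto <|
    squeeze_zero (fun _ => sq_nonneg _) (fun _ => le_add_of_nonneg_left (sq_nonneg _))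
      (tendsto_sq_sub_add_sq_sub hN h a hr)

theorem continuous_limit (hN : 0 < N) (h : ∀ a, RadialProfile N a (u a) (v a))
    (hα : ∀ a, Tendsto (mass (v a)) atTop (𝓝 (α a))) : Continuous α := by
  have hmass : ∀ {r : ℝ}, 0 ≤ r → Continuous fun a => mass (v a) r := fun hr =>
    (continuous_const.mul (continuous_v_param hN h hr)).neg
  have hflux : ∀ {r : ℝ}, 0 ≤ r → Continuous fun a => flux N (u a) r := fun hr =>
    continuous_const.mul (continuous_const.mul (Real.continuous_exp.comp
      (continuous_const.mul (continuous_u_param hN h hr))))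
  refine continuous_iff_continuousAt.2 fun a => tendsto_order.2 ⟨fun l hl => ?_, fun l hl => ?_⟩
  · obtain ⟨r, hr, hr0⟩ :=
      (((hα a).eventually (lt_mem_nhds hl)).and (eventually_ge_atTop 0)).exists
    filter_upwards [(hmass hr0).continuousAt.eventually (lt_mem_nhds hr)] with b hb
    exact hb.trans_le ((h b).mass_le_limit (hα b) hr0)
  · have hgap := (h a).lt_limit hN (hα a)
    have hlim : Tendsto (fun r => mass (v a) r +
        flux N (u a) r / (2 * (mass (v a) r - (N + 1)))) atTop
        (𝓝 (α a + 0 / (2 * (α a - (N + 1))))) :=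
      (hα a).add (((h a).flux_tendsto_zero hN (hα a)).div
        (((hα a).sub_const _).const_mul 2) (by linarith))
    rw [zero_div, add_zero] at hlim
    obtain ⟨r, ⟨hr, hrm⟩, hr0⟩ := (((hlim.eventually (gt_mem_nhds hl)).and
      ((hα a).eventually (lt_mem_nhds hgap))).and (eventually_ge_atTop 0)).exists
    have hcont : ContinuousAt (fun b => mass (v b) r +
        flux N (u b) r / (2 * (mass (v b) r - (N + 1)))) a :=
      (hmass hr0).continuousAt.add ((hflux hr0).continuousAt.div
        (((hmass hr0).continuousAt.sub continuousAt_const).const_mul 2) (by linarith))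
    filter_upwards [hcont.eventually (gt_mem_nhds hr),
      (hmass hr0).continuousAt.eventually (lt_mem_nhds hrm)] with b hb hbm
    exact ((h b).limit_le_of_flux hN (hα b) hr0 hbm).trans_lt hb

end Family

theorem IsSol.radialProfile {N : ℝ} {u : ℝ → ℝ} (h : IsSol N u) :
    RadialProfile N (u 0) u (derivWithin u (Ici 0)) where
  continuousOn_u := h.1.continuousOn
  continuousOn_v := h.1.continuousOn_derivWithin (uniqueDiffOn_Ici 0) one_le_two
  u_zero := rfl
  v_zero := h.2.2.1
  hasDerivAt_u r hr := by
    have := (h.1.differentiableOn two_ne_zero r hr.le).differentiableAt (Ici_mem_nhds hr)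
    rw [derivWithin_of_mem_nhds (Ici_mem_nhds hr)]
    exact this.hasDerivAt
  hasDerivAt_v r hr := by
    have hev : derivWithin u (Ici 0) =ᶠ[𝓝 r] deriv u := by
      filter_upwards [lt_mem_nhds hr] with s hs
      exact derivWithin_of_mem_nhds (Ici_mem_nhds hs)
    have hd : DifferentiableAt ℝ (deriv u) r := by
      have h2 : ContDiffOn ℝ 1 (derivWithin u (Ici 0)) (Ici 0) :=
        h.1.derivWithin (uniqueDiffOn_Ici 0) (by norm_num)
      exact ((h2.differentiableOn one_ne_zero r hr.le).differentiableAt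
        (Ici_mem_nhds hr)).congr_of_eventuallyEq hev.symm
    refine (hd.hasDerivAt.congr_of_eventuallyEq hev).congr_deriv ?_
    rw [hev.self_of_nhds]
    linarith [h.2.1 r hr]

theorem IsSol.tendsto_mass {N : ℝ} {u : ℝ → ℝ} (h : IsSol N u) :
    Tendsto (mass (derivWithin u (Ici 0))) atTop
      (𝓝 (∫ r in Ioi (0:ℝ), (1 + r ^ 2) ^ N * Real.exp (2 * u r) * r)) := by
  refine (intervalIntegral_tendsto_integral_Ioi 0 h.2.2.2 tendsto_id).congr' ?_
  filter_upwards [eventually_ge_atTop 0] with R hR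
  have hp := h.radialProfile
  rw [id_eq, intervalIntegral.integral_eq_sub_of_hasDerivAt_of_le
    (f' := fun r => (1 + r ^ 2) ^ N * Real.exp (2 * u r) * r) hR
    (continuousOn_Icc_of_Ici hp.continuousOn_mass le_rfl R)
    (fun r hr => (hp.hasDerivAt_mass hr.1).congr_deriv (mul_comm _ _)) ?_,
    RadialProfile.mass_zero, sub_zero]
  rw [intervalIntegrable_iff_integrableOn_Ioc_of_le hR]
  exact h.2.2.2.mono_set Ioc_subset_Ioi_self

/-- There exists `N₀ ∈ (1,2)` such that for every `N > N₀`: `α_N = inf_a α(a) < 2N`,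
and every level `α₀ ∈ (α_N, 2N)` is attained at two distinct parameters; i.e. for
such `α₀` there exist at least two distinct radial solutions at level `α₀`. -/
theorem multiplicity_above_N0 :
    ∃ N₀ ∈ Ioo (1:ℝ) 2, ∀ N : ℝ, N₀ < N →
      ∀ u : ℝ → ℝ → ℝ, (∀ a : ℝ, IsSol N (u a) ∧ u a 0 = a) →
      ∀ α : ℝ → ℝ,
        (∀ a : ℝ, α a = ∫ r in Ioi (0:ℝ), (1 + r ^ 2) ^ N * Real.exp (2 * u a r) * r) →
        (⨅ a : ℝ, α a) < 2 * N ∧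
        ∀ α₀ ∈ Ioo (⨅ a : ℝ, α a) (2 * N),
          (∃ a₁ a₂ : ℝ, a₁ ≠ a₂ ∧ α a₁ = α₀ ∧ α a₂ = α₀) ∧
          (∃ v w : ℝ → ℝ, IsSolAtLevel N α₀ v ∧ IsSolAtLevel N α₀ w ∧
            ¬ EqOn v w (Ici 0)) := by
  refine ⟨3 / 2, by norm_num, fun N hN u hu α hα => ?_⟩
  have hN1 : 1 < N := by linarith
  have hN0 : 0 < N := by linarith
  have hprof : ∀ a, RadialProfile N a (u a) (derivWithin (u a) (Ici 0)) := fun a => by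
    have := (hu a).1.radialProfile
    rwa [(hu a).2] at this
  have hlim : ∀ a, Tendsto (mass (derivWithin (u a) (Ici 0))) atTop (𝓝 (α a)) := fun a => by
    rw [hα a]
    exact (hu a).1.tendsto_mass
  have hcont : Continuous α := continuous_limit hN0 hprof hlim
  have hbdd : BddBelow (range α) := by
    refine ⟨N + 1, ?_⟩
    rintro _ ⟨a, rfl⟩
    exact ((hprof a).lt_limit hN0 (hlim a)).le
  obtain ⟨A, hA⟩ := exists_forall_ge_limit_lt hN1
  refine ⟨(ciInf_le hbdd A).trans_lt (hA A le_rfl _ _ _ (hprof A) (hlim A)), ?_⟩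
  rintro α₀ ⟨hlo, hhi⟩
  obtain ⟨b, hb⟩ := exists_lt_of_ciInf_lt hlo
  obtain ⟨C, hC⟩ := exists_forall_ge_lt_limit hN1 hhi
  obtain ⟨B, hB⟩ := exists_forall_le_lt_limit hN1
  have hleft : α₀ < α (min B b) :=
    hhi.trans (hB _ (min_le_left _ _) _ _ _ (hprof _) (hlim _))
  have hright : α₀ < α (max C b) := hC _ (le_max_left _ _) _ _ _ (hprof _) (hlim _)
  obtain ⟨a₁, ha₁, h₁⟩ := intermediate_value_Icc' (min_le_right B b) hcont.continuousOn
    ⟨hb.le, hleft.le⟩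
  obtain ⟨a₂, ha₂, h₂⟩ := intermediate_value_Icc (le_max_right C b) hcont.continuousOn
    ⟨hb.le, hright.le⟩
  have hne : a₁ ≠ a₂ := by
    rintro rfl
    have : a₁ = b := le_antisymm ha₁.2 ha₂.1
    rw [this] at h₁
    exact hb.ne h₁
  refine ⟨⟨a₁, a₂, hne, h₁, h₂⟩, u a₁, u a₂, ?_, ?_, fun heq => hne ?_⟩
  · obtain ⟨p, q, s, t⟩ := (hu a₁).1
    exact ⟨p, q, s, t, by rw [← hα, h₁]⟩
  · obtain ⟨p, q, s, t⟩ := (hu a₂).1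
    exact ⟨p, q, s, t, by rw [← hα, h₂]⟩
  · rw [← (hu a₁).2, ← (hu a₂).2]
    exact heq self_mem_Ici
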